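/- arXiv:1407.3861 — 4 statements merged into one kernel-verified Lean document; each statement's English description precedes it below -/
import Mathlib

section
/- Let r be a binary relation on a type α. Then the set W₀ = {x : α | insert x (trcl_r(x)) is r-well-founded} is itself r-well-founded, i.e. every nonempty subset of W₀ has an r-minimal element. -/
/-- The set `W₀` of `x` such that `insert x (trcl_r x)` is `r`-well-founded is
itself `r`-well-founded. -/
theorem wf_class_wellFoundedOn {α : Type*} (r : α → α → Prop) :
    Set.WellFoundedOn
      {x : α | (insert x {y | Relation.TransGen r y x}).WellFoundedOn r} r := by
  refine ⟨fun x => InvImage.accessible Subtype.val ?_⟩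
  exact (Set.WellFoundedOn.acc_iff_wellFoundedOn.out 0 2).2
    (Set.WellFoundedOn.subset x.2 (Set.subset_insert _ _))
end

section
/- In the Fregean setup, suppose j : ZFSet → α satisfies the recursion hypothesis. Then j is injective, and for all ZF-sets x and y: y ∈ x if and only if (j y) η (j x). In particular j is an embedding of (ZFSet, ∈) into (α, η). -/
/-- If `j : ZFSet → α` satisfies the recursion equation
`j x = ∂ (j '' {y | y ∈ x})`, then `j` is injective and is an embedding of
`(ZFSet, ∈)` into `(α, η)`. -/
theorem frege_embedding {α : Type*} (D : Set (Set α)) (d : Set α → α)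
    (hinj : ∀ B ∈ D, ∀ B' ∈ D, d B = d B' → B = B')
    (η : α → α → Prop) (hη : ∀ a b : α, η a b ↔ ∃ B ∈ D, d B = b ∧ a ∈ B)
    (j : ZFSet → α)
    (hjD : ∀ x : ZFSet, j '' {y : ZFSet | y ∈ x} ∈ D)
    (hj : ∀ x : ZFSet, j x = d (j '' {y : ZFSet | y ∈ x})) :
    Function.Injective j ∧ ∀ x y : ZFSet, y ∈ x ↔ η (j y) (j x) := by
  have key : ∀ x y : ZFSet, j x = j y → j '' {z : ZFSet | z ∈ x} = j '' {z : ZFSet | z ∈ y} :=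
    fun x y h => hinj _ (hjD x) _ (hjD y) (by rw [← hj, ← hj, h])
  have inj : ∀ x y : ZFSet, j x = j y → x = y := by
    intro x
    induction x using ZFSet.inductionOn with
    | h x ih =>
      intro y hxy
      have himage := key x y hxy
      ext z
      constructor
      · intro hz
        obtain ⟨w, hw, hwz⟩ := himage.subset (Set.mem_image_of_mem j hz)
        rw [ih z hz w hwz.symm]
        exact hw
      · intro hz
        obtain ⟨w, hw, hwz⟩ := himage.superset (Set.mem_image_of_mem j hz)
        rw [← ih w hw z hwz]
        exact hw
  refine ⟨fun x y h => inj x y h, fun x y => ?_⟩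
  rw [hη]
  constructor
  · intro h
    exact ⟨_, hjD x, (hj x).symm, Set.mem_image_of_mem j h⟩
  · rintro ⟨B, hB, hBx, hy⟩
    rw [hinj B hB _ (hjD x) (hBx.trans (hj x))] at hy
    obtain ⟨w, hw, hwy⟩ := hy
    rw [← inj w y hwy]
    exact hw
end

section
/- In the Fregean setup, suppose j : ZFSet → α satisfies the recursion hypothesis. Then for every ZF-set x: every element of insert (j x) (trcl_η(j x)) lies in the range of j (and in particular is an extension), and the set insert (j x) (trcl_η(j x)) is η-well-founded. -/
/-- The `η`-members of `j x` are exactly the values of `j` at the members of `x`. -/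
theorem frege_mem_image_iff {α : Type*} {D : Set (Set α)} {d : Set α → α}
    (hinj : ∀ B ∈ D, ∀ B' ∈ D, d B = d B' → B = B')
    {η : α → α → Prop} (hη : ∀ a b : α, η a b ↔ ∃ B ∈ D, d B = b ∧ a ∈ B)
    {j : ZFSet → α}
    (hjD : ∀ x : ZFSet, j '' {y : ZFSet | y ∈ x} ∈ D)
    (hj : ∀ x : ZFSet, j x = d (j '' {y : ZFSet | y ∈ x})) (a : α) (x : ZFSet) :
    η a (j x) ↔ ∃ y ∈ x, j y = a := by
  rw [hη]
  constructor
  · rintro ⟨B, hB, hBx, ha⟩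
    rw [hinj B hB _ (hjD x) (hBx.trans (hj x))] at ha
    exact ha
  · intro h
    exact ⟨_, hjD x, (hj x).symm, h⟩


/-- If `j : ZFSet → α` satisfies the recursion equation, then for every ZF-set
`x`, every element of `insert (j x) (trcl_η (j x))` lies in the range of `j`
(and is an extension), and this set is η-well-founded. -/
theorem frege_image_wf {α : Type*} (D : Set (Set α)) (d : Set α → α)
    (hinj : ∀ B ∈ D, ∀ B' ∈ D, d B = d B' → B = B')
    (η : α → α → Prop) (hη : ∀ a b : α, η a b ↔ ∃ B ∈ D, d B = b ∧ a ∈ B)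
    (j : ZFSet → α)
    (hjD : ∀ x : ZFSet, j '' {y : ZFSet | y ∈ x} ∈ D)
    (hj : ∀ x : ZFSet, j x = d (j '' {y : ZFSet | y ∈ x})) :
    ∀ x : ZFSet,
      (∀ a ∈ insert (j x) {y : α | Relation.TransGen η y (j x)},
        a ∈ Set.range j ∧ ∃ B ∈ D, d B = a) ∧
      (insert (j x) {y : α | Relation.TransGen η y (j x)}).WellFoundedOn η := by
  have mem_iff := frege_mem_image_iff hinj hη hjD hj
  have acc_image (x : ZFSet) : Acc η (j x) := by
    induction x using ZFSet.inductionOn with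
    | _ x ih =>
      refine ⟨_, fun a ha => ?_⟩
      obtain ⟨y, hy, rfl⟩ := (mem_iff a x).1 ha
      exact ih y hy
  have mem_range_of_transGen {a b : α} (h : Relation.TransGen η a b) :
      b ∈ Set.range j → a ∈ Set.range j := by
    induction h using Relation.TransGen.head_induction_on with
    | single h =>
      rintro ⟨x, rfl⟩
      obtain ⟨y, -, rfl⟩ := (mem_iff _ x).1 h
      exact ⟨y, rfl⟩
    | head h _ ih =>
      intro hb
      obtain ⟨x, rfl⟩ := ih hb
      obtain ⟨y, -, rfl⟩ := (mem_iff _ x).1 h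
      exact ⟨y, rfl⟩
  intro x
  have mem_range : ∀ a ∈ insert (j x) {y : α | Relation.TransGen η y (j x)},
      a ∈ Set.range j := by
    rintro a (rfl | ha)
    · exact ⟨x, rfl⟩
    · exact mem_range_of_transGen ha ⟨x, rfl⟩
  refine ⟨fun a ha => ⟨mem_range a ha, ?_⟩, ⟨fun ⟨a, ha⟩ => ?_⟩⟩
  · obtain ⟨y, rfl⟩ := mem_range a ha
    exact ⟨_, hjD y, (hj y).symm⟩
  · obtain ⟨y, rfl⟩ := mem_range a ha
    exact InvImage.accessible Subtype.val (acc_image y)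
end

section
/- Let L be a first-order language containing a binary relation symbol s, and let M be an L-structure in which s is interpreted as a well-order of M (a linear order on M whose strict part is well-founded). For A ⊆ M, let dcl(A) be the set of all a ∈ M such that some L-formula with parameters from A defines the singleton {a} in M. Then dcl(A) contains the interpretations of all constant symbols, is closed under the interpretations of all function symbols of L, and the substructure of M with underlying set dcl(A) is an elementary substructure of M. -/
open FirstOrder FirstOrder.Language FirstOrder.Language.Structure

namespace Set

variable {L : Language} {M : Type*} [L.Structure M] {A B : Set M}

/-- A constant function whose value is definable over `A` is definable over `A`. -/
theorem Definable₁.definableFun_const {b : M} (hb : A.Definable₁ L {b}) (α : Type*) :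
    A.DefinableFun L (fun _ : α → M => b) := by
  unfold DefinableFun
  convert! Definable.preimage_comp (fun _ : Fin 1 => (none : Option α)) hb using 1
  ext w
  simp [Function.tupleGraph, eq_comm]

/-- A set definable over elements which are definable over `A` is itself definable over `A`. -/
theorem Definable.trans_singleton {α : Type*} [Finite α] {s : Set (α → M)}
    (hs : B.Definable L s) (hB : ∀ b ∈ B, A.Definable₁ L {b}) : A.Definable L s := by
  obtain ⟨B₀, hB₀, hs⟩ := definable_iff_finitely_definable.1 hs
  obtain ⟨φ, rfl⟩ := definable_iff_exists_formula_sum.1 hs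
  have hφ : A.Definable L (Set.ofPred (φ.Realize (M := M))) :=
    (empty_definable_iff.2 ⟨φ, rfl⟩).mono (empty_subset A)
  refine hφ.preimage_map
    (F := fun v => Sum.elim (fun b : (B₀ : Set M) => (b : M)) v) ?_
  rintro (b | i)
  · exact (hB b (hB₀ b.2)).definableFun_const α
  · exact DefinableFun.proj L

/-- The set of least elements of a definable set with respect to a definable relation is
definable. -/
theorem Definable₁.least {D : Set M} {r : M → M → Prop} (hD : A.Definable₁ L D)
    (hr : A.Definable₂ L {p : M × M | r p.1 p.2}) :
    A.Definable₁ L {x | x ∈ D ∧ ∀ y ∈ D, r x y} := by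
  have hD' : A.Definable L {w : Fin 1 ⊕ Fin 1 → M | w (Sum.inr 0) ∈ D} :=
    hD.preimage_comp (fun _ => Sum.inr 0)
  have hr' : A.Definable L {w : Fin 1 ⊕ Fin 1 → M | r (w (Sum.inl 0)) (w (Sum.inr 0))} :=
    hr.preimage_comp ![Sum.inl 0, Sum.inr 0]
  unfold Definable₁
  convert! hD.inter (hD'.himp hr').forall_of_finite using 1
  ext v
  simp only [mem_ofPred_eq, mem_inter_iff, himp_eq, sup_eq_union, mem_union, mem_compl_iff,
    Sum.elim_inl, Sum.elim_inr]
  refine and_congr_right fun _ => ⟨fun h u => ?_, fun h y hy => ?_⟩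
  · exact or_iff_not_imp_right.2 fun hu => h _ (not_not.1 hu)
  · exact (h fun _ => y).resolve_right (not_not.2 hy)

end Set

namespace FirstOrder.Language

variable {L : Language} {M : Type*} [L.Structure M]

/-- If a well-founded total antisymmetric relation is definable over `A`, then the definable
closure of `A` meets all nonempty sets definable over it. -/
theorem meetsDefinable_setOf_definable_singleton {A : Set M} {le : M → M → Prop}
    (hle : A.Definable₂ L {p : M × M | le p.1 p.2})
    (hrefl : ∀ a : M, le a a)
    (hantisymm : ∀ a b : M, le a b → le b a → a = b)
    (htotal : ∀ a b : M, le a b ∨ le b a)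
    (hwf : WellFounded (fun a b : M => le a b ∧ a ≠ b)) :
    L.MeetsDefinable {a : M | A.Definable₁ L {a}} := by
  intro D hne hD
  have hDA : A.Definable₁ L D := Set.Definable.trans_singleton hD fun _ hb => hb
  obtain ⟨m, hm, hmin⟩ := hwf.has_min D hne
  have hleast : ∀ y ∈ D, le m y := fun y hy => by
    by_contra h
    exact hmin y hy ⟨(htotal m y).resolve_left h, fun e => h (e ▸ hrefl y)⟩
  refine ⟨m, hm, ?_⟩
  have hsingle : {x | x ∈ D ∧ ∀ y ∈ D, le x y} = {m} := by
    ext x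
    refine ⟨fun hx => hantisymm x m (hx.2 m hm) (hleast x hx.1), ?_⟩
    rintro rfl
    exact ⟨hm, hleast⟩
  have := hDA.least hle
  rwa [hsingle] at this

end FirstOrder.Language

/-- If the binary relation symbol `s` is interpreted in `M` as a well-order, then
the definable closure `dcl A` of a set of parameters `A` contains all constants,
is closed under the functions of the language, and carries an elementary
substructure of `M`. -/
theorem dcl_isElementary {L : Language} {M : Type*} [L.Structure M]
    (s : L.Relations 2)
    (le : M → M → Prop) (hle : ∀ a b : M, le a b ↔ RelMap s ![a, b])
    (hrefl : ∀ a : M, le a a)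
    (hantisymm : ∀ a b : M, le a b → le b a → a = b)
    (htrans : ∀ a b c : M, le a b → le b c → le a c)
    (htotal : ∀ a b : M, le a b ∨ le b a)
    (hwf : WellFounded (fun a b : M => le a b ∧ a ≠ b))
    (A : Set M) (dcl : Set M)
    (hdcl : dcl = {a : M | ∃ φ : L[[A]].Formula (Fin 1),
      ∀ a' : M, φ.Realize ![a'] ↔ a' = a}) :
    (∀ c : L.Constants, (constantMap c : M) ∈ dcl) ∧
    (∀ (n : ℕ) (f : L.Functions n) (v : Fin n → M),
      (∀ i : Fin n, v i ∈ dcl) → funMap f v ∈ dcl) ∧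
    (∃ S : L.Substructure M, (S : Set M) = dcl ∧ S.IsElementary) := by
  have hdcl' : dcl = {a : M | A.Definable₁ L {a}} := by
    rw [hdcl]
    ext a
    refine exists_congr fun φ => ⟨fun h => ?_, fun h a' => ?_⟩
    · ext v
      have hv : ![v 0] = v := by
        ext i
        fin_cases i
        rfl
      have := h (v 0)
      rw [hv] at this
      exact this.symm
    · exact (Set.ext_iff.1 h ![a']).symm
  have hle' : A.Definable₂ L {p : M × M | le p.1 p.2} := by
    refine Set.Definable.mono (Set.empty_definable_iff.2
      ⟨s.formula₂ (Term.var 0) (Term.var 1), ?_⟩) (Set.empty_subset A)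
    ext v
    simp [hle, Formula.realize_rel₂]
  have hmeets : L.MeetsDefinable dcl :=
    hdcl' ▸ meetsDefinable_setOf_definable_singleton hle' hrefl hantisymm htotal hwf
  have hcl : (Substructure.closure L dcl : Set M) = dcl := hmeets.closure_eq_self
  refine ⟨fun c => ?_, fun n f v hv => ?_, Substructure.closure L dcl, hcl,
    hmeets.isElementary_closure⟩
  · rw [← hcl]
    exact Substructure.constants_mem c
  · rw [← hcl] at hv ⊢
    exact (Substructure.closure L dcl).fun_mem f v hv
end
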